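/- arXiv:1803.09703 — 4 statements merged into one kernel-verified Lean document; each statement's English description precedes it below -/
import Mathlib

section
/- For every computation w ∈ Ops*, we have ⟦w⟧ = 1 if and only if w admits a reduction, i.e., w can be transformed into the empty word by finitely many applications of the rules (R1), (R2), (R3). -/
/-- Operations on the symbols of a graph: a positive (`o⁺`) and a negative (`o⁻`)
operation for each symbol `o`. -/
inductive Op (V : Type) : Type
  | pos : V → Op V
  | neg : V → Op V

/-- The underlying symbol of an operation. -/
def Op.sym {V : Type} : Op V → V
  | .pos o => o
  | .neg o => o

/-- The generating relation of the graph monoid congruence, closed under contexts: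
swap two adjacent independent operations, or cancel an adjacent pair `o⁺ o⁻`. -/
inductive MGen {V : Type} (I : V → V → Prop) : List (Op V) → List (Op V) → Prop
  | swap (s t : List (Op V)) (a b : Op V) (h : I a.sym b.sym) :
      MGen I (s ++ [a, b] ++ t) (s ++ [b, a] ++ t)
  | cancel (s t : List (Op V)) (o : V) :
      MGen I (s ++ [Op.pos o, Op.neg o] ++ t) (s ++ t)

/-- The monoid congruence `≅` on computations: the smallest congruence containing
`o₁^± o₂^± ≅ o₂^± o₁^±` for `(o₁,o₂) ∈ I` and `o⁺ o⁻ ≅ ε`.  In particular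
`MCong I w []` expresses `⟦w⟧ = 1`. -/
def MCong {V : Type} (I : V → V → Prop) : List (Op V) → List (Op V) → Prop :=
  Relation.EqvGen (MGen I)

/-- The rewriting rules (R1), (R2), (R3). -/
inductive RStep {V : Type} (I : V → V → Prop) : List (Op V) → List (Op V) → Prop
  | r1 (s t : List (Op V)) (o : V) :
      RStep I (s ++ [Op.pos o, Op.neg o] ++ t) (s ++ t)
  | r2 (s t : List (Op V)) (o : V) (h : I o o) :
      RStep I (s ++ [Op.neg o, Op.pos o] ++ t) (s ++ t)
  | r3 (s t : List (Op V)) (a b : Op V) (h : I a.sym b.sym) (hne : a.sym ≠ b.sym) :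
      RStep I (s ++ [a, b] ++ t) (s ++ [b, a] ++ t)

/-- `w` admits a reduction: it can be transformed into `ε` by finitely many
applications of (R1), (R2), (R3). -/
def HasReduction {V : Type} (I : V → V → Prop) (w : List (Op V)) : Prop :=
  Relation.ReflTransGen (RStep I) w []

/-- The pairs of letters that may be deleted when adjacent. -/
inductive Cancels {V : Type} (I : V → V → Prop) : Op V → Op V → Prop
  | pos_neg (o : V) : Cancels I (Op.pos o) (Op.neg o)
  | neg_pos (o : V) (h : I o o) : Cancels I (Op.neg o) (Op.pos o)

/-- Two letters carry distinct independent symbols, so that (R3) may swap them. -/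
def Indep {V : Type} (I : V → V → Prop) (a b : Op V) : Prop :=
  I a.sym b.sym ∧ a.sym ≠ b.sym

section

variable {V : Type} {I : V → V → Prop}

theorem Indep.symm (hsym : ∀ a b : V, I a b → I b a) {a b : Op V} (h : Indep I a b) :
    Indep I b a :=
  ⟨hsym _ _ h.1, h.2.symm⟩

theorem Cancels.sym_eq {a b : Op V} (h : Cancels I a b) : a.sym = b.sym := by
  cases h <;> rfl

theorem Cancels.eq_of_cancels {a b c : Op V} (h : Cancels I a b) (h' : Cancels I b c) :
    a = c := by
  cases h <;> cases h' <;> rfl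

theorem RStep.of_cancels {a b : Op V} (h : Cancels I a b) (s t : List (Op V)) :
    RStep I (s ++ a :: b :: t) (s ++ t) := by
  cases h with
  | pos_neg o => simpa using RStep.r1 (I := I) s t o
  | neg_pos o h => simpa using RStep.r2 (I := I) s t o h

theorem RStep.of_indep {a b : Op V} (h : Indep I a b) (s t : List (Op V)) :
    RStep I (s ++ a :: b :: t) (s ++ b :: a :: t) := by
  simpa using RStep.r3 (I := I) s t a b h.1 h.2

theorem RStep.exists_eq {u v : List (Op V)} (h : RStep I u v) :
    ∃ s t x y, u = s ++ x :: y :: t ∧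
      ((Cancels I x y ∧ v = s ++ t) ∨ (Indep I x y ∧ v = s ++ y :: x :: t)) := by
  cases h with
  | r1 s t o => exact ⟨s, t, _, _, by simp, .inl ⟨.pos_neg o, rfl⟩⟩
  | r2 s t o h => exact ⟨s, t, _, _, by simp, .inl ⟨.neg_pos o h, rfl⟩⟩
  | r3 s t a b h hne => exact ⟨s, t, a, b, by simp, .inr ⟨⟨h, hne⟩, by simp⟩⟩

theorem HasReduction.of_step {u v : List (Op V)} (h : RStep I u v) (hv : HasReduction I v) :
    HasReduction I u :=
  Relation.ReflTransGen.head h hv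

/-- If `m ++ [b]` reduces in context, so does `[b] ++ m`, for `b` independent of `m`. -/
theorem HasReduction.move_left {b : Op V} {m : List (Op V)} (hm : ∀ c ∈ m, Indep I b c)
    (s t : List (Op V)) (h : HasReduction I (s ++ (m ++ b :: t))) :
    HasReduction I (s ++ b :: (m ++ t)) := by
  induction m generalizing s with
  | nil => exact h
  | cons c m ih =>
    refine .of_step (.of_indep (hm c (by simp)) s (m ++ t)) ?_
    have := ih (fun d hd => hm d (by simp [hd])) (s ++ [c]) (by simpa using h)
    simpa using this

/-- If `[b] ++ m` reduces in context, so does `m ++ [b]`, for `b` independent of `m`. -/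
theorem HasReduction.move_right {b : Op V} {m : List (Op V)} (hm : ∀ c ∈ m, Indep I c b)
    (s t : List (Op V)) (h : HasReduction I (s ++ b :: (m ++ t))) :
    HasReduction I (s ++ (m ++ b :: t)) := by
  induction m using List.reverseRecOn generalizing t with
  | nil => exact h
  | append_singleton m c ih =>
    have h₁ := RStep.of_indep (hm c (by simp)) (s ++ m) t
    have h₂ := ih (fun d hd => hm d (by simp [hd])) (c :: t) (by simpa using h)
    exact .of_step (by simpa using h₁) (by simpa using h₂)

/-- The position of a distinguished letter `a` relative to two adjacent letters `x`, `y`. -/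
theorem List.append_cons_cons_eq_append_cons {α : Type} {s s' t' r : List α} {x y a : α}
    (h : s' ++ x :: y :: t' = s ++ a :: r) :
    (∃ k, s = s' ++ x :: y :: k ∧ t' = k ++ a :: r) ∨
    (s = s' ++ [x] ∧ y = a ∧ t' = r) ∨
    (s = s' ∧ x = a ∧ r = y :: t') ∨
    (∃ k, s' = s ++ a :: k ∧ r = k ++ x :: y :: t') := by
  rcases List.append_eq_append_iff.1 h with ⟨k, rfl, hk⟩ | ⟨k, rfl, hk⟩
  · rcases k with _ | ⟨z, _ | ⟨z', k⟩⟩ <;> simp_all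
  · cases k <;> simp_all

/-- A cancelling pair whose letters are separated only by letters independent of them
may be deleted from a reducible word. -/
theorem HasReduction.delete_pair (hsym : ∀ a b : V, I a b → I b a) {u : List (Op V)}
    (hu : HasReduction I u) {a b : Op V} (hab : Cancels I a b) (s m t : List (Op V))
    (hm : ∀ c ∈ m, Indep I c a) (hs : u = s ++ a :: (m ++ b :: t)) :
    HasReduction I (s ++ (m ++ t)) := by
  induction hu using Relation.ReflTransGen.head_induction_on generalizing s m t with
  | refl => simp at hs
  | head hstep hv ih =>
    have hmb : ∀ c ∈ m, Indep I c b := fun c hc => by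
      simpa [Indep, hab.sym_eq] using hm c hc
    obtain ⟨s', t', x, y, rfl, hxy⟩ := hstep.exists_eq
    rcases List.append_cons_cons_eq_append_cons hs with
      ⟨k, rfl, rfl⟩ | ⟨rfl, rfl, rfl⟩ | ⟨rfl, rfl, hr⟩ | ⟨k, rfl, hr⟩
    · rcases hxy with ⟨hc, rfl⟩ | ⟨hi, rfl⟩
      · have := ih (s' ++ k) m t hm (by simp)
        exact .of_step (by simpa using RStep.of_cancels hc s' (k ++ (m ++ t)))
          (by simpa using this)
      · have := ih (s' ++ y :: x :: k) m t hm (by simp)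
        exact .of_step (by simpa using RStep.of_indep hi s' (k ++ (m ++ t)))
          (by simpa using this)
    · rcases hxy with ⟨hc, rfl⟩ | ⟨hi, rfl⟩
      · obtain rfl := hc.eq_of_cancels hab
        simpa using move_left (fun c hc => (hmb c hc).symm hsym) s' t hv
      · simpa using ih s' (x :: m) t (by simpa [hi] using hm) rfl
    · cases m with
      | nil =>
        obtain ⟨rfl, rfl⟩ : b = y ∧ t = t' := by simpa using hr
        rcases hxy with ⟨hc, rfl⟩ | ⟨hi, rfl⟩
        · exact hv
        · exact absurd hab.sym_eq hi.2
      | cons c m =>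
        obtain ⟨rfl, rfl⟩ : c = y ∧ m ++ b :: t = t' := by simpa using hr
        rcases hxy with ⟨hc, rfl⟩ | ⟨hi, rfl⟩
        · exact absurd hc.sym_eq.symm (hm c (by simp)).2
        · simpa using ih (s ++ [c]) m t (fun d hd => hm d (by simp [hd])) (by simp)
    · rcases List.append_cons_cons_eq_append_cons hr.symm with
        ⟨l, rfl, rfl⟩ | ⟨rfl, rfl, rfl⟩ | ⟨rfl, rfl, rfl⟩ | ⟨l, rfl, rfl⟩
      · rcases hxy with ⟨hc, rfl⟩ | ⟨hi, rfl⟩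
        · have := ih s (k ++ l) t (fun d hd => hm d (by simp at hd ⊢; tauto)) (by simp)
          exact .of_step (by simpa using RStep.of_cancels hc (s ++ k) (l ++ t))
            (by simpa using this)
        · have := ih s (k ++ y :: x :: l) t (fun d hd => hm d (by simp at hd ⊢; tauto))
            (by simp)
          exact .of_step (by simpa using RStep.of_indep hi (s ++ k) (l ++ t))
            (by simpa using this)
      · rcases hxy with ⟨hc, rfl⟩ | ⟨hi, rfl⟩
        · exact absurd hc.sym_eq (hmb x (by simp)).2
        · simpa using ih s k (x :: t') (fun d hd => hm d (by simp [hd])) (by simp)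
      · rcases hxy with ⟨hc, rfl⟩ | ⟨hi, rfl⟩
        · obtain rfl := hab.eq_of_cancels hc
          rw [List.append_assoc, List.cons_append] at hv
          exact move_right hm s t' hv
        · have hya : Indep I y a := by
            simpa [Indep, hab.sym_eq] using hi.symm hsym
          simpa using ih s (m ++ [y]) t'
            (fun d hd => by
              rcases List.mem_append.1 hd with hd | hd
              · exact hm d hd
              · rwa [List.mem_singleton.1 hd])
            (by simp)
      · rcases hxy with ⟨hc, rfl⟩ | ⟨hi, rfl⟩
        · have := ih s m (l ++ t') hm (by simp)
          exact .of_step (by simpa using RStep.of_cancels hc (s ++ (m ++ l)) t')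
            (by simpa using this)
        · have := ih s m (l ++ y :: x :: t') hm (by simp)
          exact .of_step (by simpa using RStep.of_indep hi (s ++ (m ++ l)) t')
            (by simpa using this)

theorem hasReduction_cancels_iff (hsym : ∀ a b : V, I a b → I b a) {a b : Op V}
    (h : Cancels I a b) (s t : List (Op V)) :
    HasReduction I (s ++ a :: b :: t) ↔ HasReduction I (s ++ t) :=
  ⟨fun hu => hu.delete_pair hsym h s [] t (by simp) rfl, .of_step (.of_cancels h s t)⟩

theorem MGen.hasReduction_iff (hsym : ∀ a b : V, I a b → I b a) {u v : List (Op V)}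
    (h : MGen I u v) : HasReduction I u ↔ HasReduction I v := by
  cases h with
  | cancel s t o => simpa using hasReduction_cancels_iff hsym (.pos_neg o) s t
  | swap s t a b h =>
    simp only [List.append_assoc, List.cons_append, List.nil_append]
    by_cases hne : a.sym = b.sym
    · cases a <;> cases b <;> obtain rfl := hne
      · rfl
      · exact (hasReduction_cancels_iff hsym (.pos_neg _) s t).trans
          (hasReduction_cancels_iff hsym (.neg_pos _ h) s t).symm
      · exact (hasReduction_cancels_iff hsym (.neg_pos _ h) s t).trans
          (hasReduction_cancels_iff hsym (.pos_neg _) s t).symm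
      · rfl
    · have hi : Indep I a b := ⟨h, hne⟩
      exact ⟨.of_step (.of_indep (hi.symm hsym) s t), .of_step (.of_indep hi s t)⟩

theorem MCong.hasReduction_iff (hsym : ∀ a b : V, I a b → I b a) {u v : List (Op V)}
    (h : MCong I u v) : HasReduction I u ↔ HasReduction I v := by
  induction h with
  | rel _ _ h => exact h.hasReduction_iff hsym
  | refl => rfl
  | symm _ _ _ ih => exact ih.symm
  | trans _ _ _ _ _ ih₁ ih₂ => exact ih₁.trans ih₂

theorem RStep.mcong {u v : List (Op V)} (h : RStep I u v) : MCong I u v := by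
  cases h with
  | r1 s t o => exact .rel _ _ (.cancel s t o)
  | r2 s t o h =>
    exact .trans _ _ _ (.rel _ _ (.swap s t (.neg o) (.pos o) h)) (.rel _ _ (.cancel s t o))
  | r3 s t a b h _ => exact .rel _ _ (.swap s t a b h)

theorem HasReduction.mcong {w : List (Op V)} (h : HasReduction I w) : MCong I w [] := by
  induction h using Relation.ReflTransGen.head_induction_on with
  | refl => exact .refl _
  | head hstep _ ih => exact .trans _ _ _ hstep.mcong ih

end

/-- For every computation `w`, `⟦w⟧ = 1` iff `w` admits a reduction. -/
theorem mcong_one_iff_hasReduction {V : Type} (I : V → V → Prop)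
    (hsym : ∀ a b : V, I a b → I b a) (w : List (Op V)) :
    MCong I w [] ↔ HasReduction I w := by
  exact ⟨fun h => (h.hasReduction_iff hsym).2 .refl, HasReduction.mcong⟩
end

section
/- If u and v are irreducible, dependent computations with ⟦u·v⟧ = 1, then v = syninv(u), the syntactic inverse of u. -/
/-- A computation is dependent if no two distinct symbols occurring in it are
`I`-related. -/
def DependentWord {V : Type} (I : V → V → Prop) (w : List (Op V)) : Prop :=
  ∀ a ∈ w, ∀ b ∈ w, Op.sym a ≠ Op.sym b → ¬ I (Op.sym a) (Op.sym b)
/-- A computation is irreducible if no pair `o⁺ … o⁻` (or `o⁻ … o⁺` when `(o,o) ∈ I`)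
can be cancelled after commuting, i.e. it has no factorization `w' a u b w''` where
`a, b` are complementary operations on a symbol `o` that is `I`-related to every
symbol occurring in `u`. -/
def IrreducibleComp {V : Type} (I : V → V → Prop) (w : List (Op V)) : Prop :=
  ¬ ∃ (w' u w'' : List (Op V)) (o : V),
    (w = w' ++ [Op.pos o] ++ u ++ [Op.neg o] ++ w'' ∧ ∀ a ∈ u, I o (Op.sym a)) ∨
    (w = w' ++ [Op.neg o] ++ u ++ [Op.pos o] ++ w'' ∧ I o o ∧ ∀ a ∈ u, I o (Op.sym a))
/-- Inverting the polarity of an operation. -/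
def Op.invert {V : Type} : Op V → Op V
  | .pos o => .neg o
  | .neg o => .pos o

/-- The syntactic inverse of a computation: reverse the word and invert the
polarity of every operation. -/
def synInv {V : Type} (w : List (Op V)) : List (Op V) :=
  (w.map Op.invert).reverse

/-- The adjacent pairs of operations that may be cancelled in an irreducible computation:
`o⁺ o⁻`, and `o⁻ o⁺` if `o` carries a self-loop. -/
inductive Cancels_s6 {V : Type} (I : V → V → Prop) : Op V → Op V → Prop
  | pos_neg (o : V) : Cancels_s6 I (.pos o) (.neg o)
  | neg_pos (o : V) (h : I o o) : Cancels_s6 I (.neg o) (.pos o)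

/-- A word is reduced if no two adjacent operations cancel. -/
def ReducedWord {V : Type} (I : V → V → Prop) (w : List (Op V)) : Prop :=
  w.IsChain (fun x y => ¬ Cancels_s6 I x y)

open Classical in
/-- Prepend an operation to a word, cancelling it against the first letter if possible. -/
noncomputable def pushOp {V : Type} (I : V → V → Prop) (x : Op V) : List (Op V) → List (Op V)
  | [] => [x]
  | y :: t => if Cancels_s6 I x y then t else x :: y :: t

open Classical in
/-- The reduced form of the subword of operations on symbols in `S`. -/
noncomputable def reduceOn {V : Type} (I : V → V → Prop) (S : Set V) (w : List (Op V)) :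
    List (Op V) :=
  (w.filter (fun a => a.sym ∈ S)).foldr (pushOp I) []

section

variable {V : Type} {I : V → V → Prop}

@[simp] theorem Op.invert_invert (x : Op V) : x.invert.invert = x := by
  cases x <;> rfl

theorem synInv_append_singleton (u : List (Op V)) (x : Op V) :
    synInv (u ++ [x]) = x.invert :: synInv u := by
  simp [synInv]

theorem Cancels_s6.eq_invert {x y : Op V} (h : Cancels_s6 I x y) : y = x.invert := by
  cases h <;> rfl

theorem Cancels_s6.sym_eq {x y : Op V} (h : Cancels_s6 I x y) : y.sym = x.sym := by
  cases h <;> rfl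

theorem pushOp_of_cancels {x y : Op V} (h : Cancels_s6 I x y) (t : List (Op V)) :
    pushOp I x (y :: t) = t := if_pos h

theorem pushOp_of_not_cancels {x y : Op V} (h : ¬ Cancels_s6 I x y) (t : List (Op V)) :
    pushOp I x (y :: t) = x :: y :: t := if_neg h

theorem ReducedWord.pushOp_eq_cons {x : Op V} {t : List (Op V)} (h : ReducedWord I (x :: t)) :
    pushOp I x t = x :: t := by
  cases t with
  | nil => rfl
  | cons y t => exact pushOp_of_not_cancels (List.isChain_cons_cons.1 h).1 t

theorem ReducedWord.tail {x : Op V} {t : List (Op V)} (h : ReducedWord I (x :: t)) :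
    ReducedWord I t :=
  List.IsChain.tail h

theorem ReducedWord.pushOp (x : Op V) {r : List (Op V)} (h : ReducedWord I r) :
    ReducedWord I (pushOp I x r) := by
  cases r with
  | nil => exact List.isChain_singleton x
  | cons y t =>
    by_cases hc : Cancels_s6 I x y
    · rw [pushOp_of_cancels hc]
      exact h.tail
    · rw [pushOp_of_not_cancels hc]
      exact List.isChain_cons_cons.2 ⟨hc, h⟩

theorem ReducedWord.foldr_pushOp (w : List (Op V)) {r : List (Op V)} (h : ReducedWord I r) :
    ReducedWord I (w.foldr (_root_.pushOp I) r) := by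
  induction w with
  | nil => exact h
  | cons x w ih => exact ih.pushOp x

theorem ReducedWord.foldr_pushOp_nil {w : List (Op V)} (h : ReducedWord I w) :
    w.foldr (_root_.pushOp I) [] = w := by
  induction w with
  | nil => rfl
  | cons x w ih => rw [List.foldr_cons, ih h.tail, h.pushOp_eq_cons]

theorem reducedWord_reduceOn (S : Set V) (w : List (Op V)) : ReducedWord I (reduceOn I S w) :=
  ReducedWord.foldr_pushOp _ List.isChain_nil

/-- Pushing both operations of a cancelling pair onto a reduced word has no effect. -/
theorem Cancels_s6.pushOp_pushOp {x y : Op V} (h : Cancels_s6 I x y) {r : List (Op V)}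
    (hr : ReducedWord I r) : pushOp I x (pushOp I y r) = r := by
  cases r with
  | nil => exact pushOp_of_cancels h []
  | cons z t =>
    by_cases hc : Cancels_s6 I y z
    · obtain rfl : z = x := by rw [hc.eq_invert, h.eq_invert, Op.invert_invert]
      rw [pushOp_of_cancels hc, hr.pushOp_eq_cons]
    · rw [pushOp_of_not_cancels hc, pushOp_of_cancels h]

theorem pushOp_comm {x y : Op V} (hxy : x.sym = y.sym) (hI : I x.sym y.sym) {r : List (Op V)}
    (hr : ReducedWord I r) : pushOp I x (pushOp I y r) = pushOp I y (pushOp I x r) := by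
  cases x with
  | pos o =>
    cases y with
    | pos p =>
      obtain rfl : o = p := hxy
      rfl
    | neg p =>
      obtain rfl : o = p := hxy
      rw [(Cancels_s6.pos_neg o).pushOp_pushOp hr, (Cancels_s6.neg_pos o hI).pushOp_pushOp hr]
  | neg o =>
    cases y with
    | pos p =>
      obtain rfl : o = p := hxy
      rw [(Cancels_s6.pos_neg o).pushOp_pushOp hr, (Cancels_s6.neg_pos o hI).pushOp_pushOp hr]
    | neg p =>
      obtain rfl : o = p := hxy
      rfl

theorem reduceOn_append (S : Set V) (s t : List (Op V)) [DecidablePred (· ∈ S)] :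
    reduceOn I S (s ++ t) =
      (s.filter (fun a => a.sym ∈ S)).foldr (pushOp I) (reduceOn I S t) := by
  simp only [reduceOn, List.filter_append, List.foldr_append]
  congr!

theorem reduceOn_append_congr {S : Set V} (s : List (Op V)) {t t' : List (Op V)}
    (h : reduceOn I S t = reduceOn I S t') :
    reduceOn I S (s ++ t) = reduceOn I S (s ++ t') := by
  classical
  rw [reduceOn_append, reduceOn_append, h]

theorem reduceOn_cons_of_mem {S : Set V} {a : Op V} (ha : a.sym ∈ S) (t : List (Op V)) :
    reduceOn I S (a :: t) = pushOp I a (reduceOn I S t) := by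
  simp [reduceOn, ha]

theorem reduceOn_cons_of_notMem {S : Set V} {a : Op V} (ha : a.sym ∉ S) (t : List (Op V)) :
    reduceOn I S (a :: t) = reduceOn I S t := by
  simp [reduceOn, ha]

theorem MGen.reduceOn_eq {S : Set V} (hS : ∀ a ∈ S, ∀ b ∈ S, a ≠ b → ¬ I a b)
    {w w' : List (Op V)} (h : MGen I w w') : reduceOn I S w = reduceOn I S w' := by
  cases h with
  | swap s t a b h =>
    rw [List.append_assoc, List.append_assoc]
    refine reduceOn_append_congr s ?_
    change reduceOn I S (a :: b :: t) = reduceOn I S (b :: a :: t)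
    by_cases ha : a.sym ∈ S <;> by_cases hb : b.sym ∈ S <;>
      simp only [ha, hb, reduceOn_cons_of_mem, reduceOn_cons_of_notMem, not_false_eq_true]
    have hab : a.sym = b.sym := by_contra fun hne => hS _ ha _ hb hne h
    exact pushOp_comm hab h (reducedWord_reduceOn S t)
  | cancel s t o =>
    rw [List.append_assoc]
    refine reduceOn_append_congr s ?_
    change reduceOn I S (.pos o :: .neg o :: t) = reduceOn I S t
    by_cases ho : o ∈ S
    · rw [reduceOn_cons_of_mem (a := .pos o) ho, reduceOn_cons_of_mem (a := .neg o) ho,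
        (Cancels_s6.pos_neg o).pushOp_pushOp (reducedWord_reduceOn S t)]
    · rw [reduceOn_cons_of_notMem (a := .pos o) ho, reduceOn_cons_of_notMem (a := .neg o) ho]

/-- For a set of symbols no two distinct of which are `I`-related, the reduced form is an
invariant of the congruence class. -/
theorem MCong.reduceOn_eq {S : Set V} (hS : ∀ a ∈ S, ∀ b ∈ S, a ≠ b → ¬ I a b)
    {w w' : List (Op V)} (h : MCong I w w') : reduceOn I S w = reduceOn I S w' := by
  induction h with
  | rel _ _ h => exact h.reduceOn_eq hS
  | refl => rfl
  | symm _ _ _ ih => exact ih.symm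
  | trans _ _ _ _ _ ih₁ ih₂ => exact ih₁.trans ih₂

theorem IrreducibleComp.reducedWord {w : List (Op V)} (h : IrreducibleComp I w) :
    ReducedWord I w := by
  refine List.isChain_iff_forall_rel_of_append_cons_cons.2 ?_
  rintro x y s t rfl hc
  cases hc with
  | pos_neg o => exact h ⟨s, [], t, o, .inl ⟨by simp, by simp⟩⟩
  | neg_pos o ho => exact h ⟨s, [], t, o, .inr ⟨by simp, ho, by simp⟩⟩

theorem reduceOn_eq_self {S : Set V} {w : List (Op V)} (hw : ReducedWord I w)
    (hS : ∀ a ∈ w, a.sym ∈ S) : reduceOn I S w = w := by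
  rw [reduceOn, List.filter_eq_self.2 (by simpa using hS), hw.foldr_pushOp_nil]

theorem mem_pushOp_of_sym_ne {a x : Op V} {r : List (Op V)} (ha : a ∈ r) (hne : a.sym ≠ x.sym) :
    a ∈ pushOp I x r := by
  cases r with
  | nil => simp at ha
  | cons y t =>
    by_cases hc : Cancels_s6 I x y
    · rw [pushOp_of_cancels hc]
      refine (List.mem_cons.1 ha).resolve_left ?_
      rintro rfl
      exact hne hc.sym_eq
    · rw [pushOp_of_not_cancels hc]
      exact List.mem_cons_of_mem x ha

theorem mem_foldr_pushOp {a : Op V} {r : List (Op V)} (ha : a ∈ r) {u : List (Op V)}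
    (hne : ∀ x ∈ u, a.sym ≠ x.sym) : a ∈ u.foldr (pushOp I) r := by
  induction u with
  | nil => exact ha
  | cons x u ih =>
    exact mem_pushOp_of_sym_ne (ih fun y hy => hne y (List.mem_cons_of_mem x hy))
      (hne x List.mem_cons_self)

theorem eq_synInv_of_foldr_pushOp_eq_nil {u : List (Op V)} (hu : ReducedWord I u)
    {r : List (Op V)} (h : u.foldr (pushOp I) r = []) :
    r = synInv u ∧ ∀ x ∈ u, Cancels_s6 I x x.invert := by
  induction u using List.reverseRecOn generalizing r with
  | nil => exact ⟨h, by simp⟩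
  | append_singleton u x ih =>
    rw [List.foldr_append] at h
    obtain ⟨hr, hc⟩ := ih hu.left_of_append h
    have key (hx : pushOp I x r = x :: r) : False := by
      change pushOp I x r = _ at hr
      rw [hx] at hr
      rcases List.eq_nil_or_concat' u with rfl | ⟨u', y, rfl⟩
      · simp [synInv] at hr
      · rw [synInv_append_singleton] at hr
        obtain rfl : x = y.invert := (List.cons.inj hr).1
        have hchain := List.isChain_iff_forall_rel_of_append_cons_cons.1 hu
        exact hchain (l₁ := u') (l₂ := []) (by simp) (hc y (by simp))
    cases r with
    | nil => exact (key rfl).elim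
    | cons y t =>
      by_cases hxy : Cancels_s6 I x y
      · obtain rfl := hxy.eq_invert
        have ht : t = synInv u := (pushOp_of_cancels hxy t).symm.trans hr
        refine ⟨by rw [synInv_append_singleton, ht], fun z hz => ?_⟩
        rcases List.mem_append.1 hz with hz | hz
        · exact hc z hz
        · rwa [List.mem_singleton.1 hz]
      · exact (key (pushOp_of_not_cancels hxy t)).elim

theorem DependentWord.not_rel {w : List (Op V)} (h : DependentWord I w) :
    ∀ a ∈ {o | ∃ x ∈ w, x.sym = o}, ∀ b ∈ {o | ∃ x ∈ w, x.sym = o}, a ≠ b → ¬ I a b := by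
  rintro _ ⟨x, hx, rfl⟩ _ ⟨y, hy, rfl⟩
  exact h x hx y hy

end

/-- If `u` and `v` are irreducible, dependent computations with `⟦u·v⟧ = 1`, then
`v` is the syntactic inverse of `u`. -/
theorem inverse_eq_synInv {V : Type} (I : V → V → Prop)
    (hsym : ∀ a b : V, I a b → I b a)
    (u v : List (Op V))
    (hu_irr : IrreducibleComp I u) (hv_irr : IrreducibleComp I v)
    (hu_dep : DependentWord I u) (hv_dep : DependentWord I v)
    (hone : MCong I (u ++ v) []) :
    v = synInv u := by
  classical
  have hu := hu_irr.reducedWord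
  have hv := hv_irr.reducedWord
  have hsub : ∀ a ∈ v, a.sym ∈ {o | ∃ x ∈ u, x.sym = o} := by
    intro a ha
    by_contra hnot
    have hself : reduceOn I {o | ∃ x ∈ v, x.sym = o} v = v :=
      reduceOn_eq_self hv fun b hb => ⟨b, hb, rfl⟩
    have h := hone.reduceOn_eq hv_dep.not_rel
    rw [reduceOn_append, hself] at h
    have hmem : a ∈ reduceOn I {o | ∃ x ∈ v, x.sym = o} [] :=
      h ▸ mem_foldr_pushOp ha fun x hx he => hnot ⟨x, List.mem_of_mem_filter hx, he.symm⟩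
    simp [reduceOn] at hmem
  have hfilter : u.filter (fun a => a.sym ∈ {o | ∃ x ∈ u, x.sym = o}) = u :=
    List.filter_eq_self.2 fun a ha => decide_eq_true ⟨a, ha, rfl⟩
  have h := hone.reduceOn_eq hu_dep.not_rel
  rw [reduceOn_append, reduceOn_eq_self hv hsub, hfilter] at h
  exact (eq_synInv_of_foldr_pushOp_eq_nil hu h).1
end

section
/- Let G = G₀ × G₁, i.e., V = V₀ ⊔ V₁ and I = I₀ ∪ I₁ ∪ {(o₀,o₁), (o₁,o₀) : o₀ ∈ V₀, o₁ ∈ V₁}, and write Opsᵢ = {o⁺,o⁻ : o ∈ Vᵢ}. Let n ≥ 0 and let w = u₀·v₁·u₁·v₂·u₂⋯vₙ·uₙ where u₀, uₙ ∈ Ops₀*, u₁, …, u_{n−1} ∈ Ops₀⁺ are nonempty, and v₁, …, vₙ ∈ Ops₁⁺ are nonempty. Then cs(w) = cs(u₀) + Σ_{i=1}^{n} (cs(vᵢ) + cs(uᵢ) + 2), where cs(ε) = −1. -/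
/-- `cs` is the context decomposition of the nonempty computation `w`: the pieces
are nonempty and dependent, they concatenate to `w`, and each context is maximal,
i.e. it cannot be extended by the first letter of the next context while staying
dependent. -/
def IsContextDecomp {V : Type} (I : V → V → Prop) (w : List (Op V))
    (cs : List (List (Op V))) : Prop :=
  cs.flatten = w ∧ cs ≠ [] ∧ (∀ c ∈ cs, c ≠ [] ∧ DependentWord I c) ∧
    List.Chain' (fun c d => ∀ a ∈ d.head?, ¬ DependentWord I (c ++ [a])) cs

/-- `HasCS I w m` expresses that the number of context switches of `w` is `m`,
i.e. `cs(w) = m`, where `cs(ε) = -1` and otherwise `cs(w)` is the number of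
contexts of `w` minus one. -/
def HasCS {V : Type} (I : V → V → Prop) (w : List (Op V)) (m : ℤ) : Prop :=
  (w = [] ∧ m = -1) ∨
    ∃ cs : List (List (Op V)), IsContextDecomp I w cs ∧ m = (cs.length : ℤ) - 1

theorem DependentWord.mono {V : Type} {I : V → V → Prop} {w w' : List (Op V)}
    (h : DependentWord I w') (hsub : w ⊆ w') : DependentWord I w :=
  fun a ha b hb => h a (hsub ha) b (hsub hb)

theorem hasCS_iff {V : Type} {I : V → V → Prop} {w : List (Op V)} {m : ℤ} :
    HasCS I w m ↔ ∃ cs : List (List (Op V)), cs.flatten = w ∧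
      (∀ c ∈ cs, c ≠ [] ∧ DependentWord I c) ∧
      cs.IsChain (fun c d => ∀ a ∈ d.head?, ¬ DependentWord I (c ++ [a])) ∧
      m = (cs.length : ℤ) - 1 := by
  constructor
  · rintro (⟨rfl, rfl⟩ | ⟨cs, ⟨hf, -, hd, hc⟩, hm⟩)
    · exact ⟨[], by simp⟩
    · exact ⟨cs, hf, hd, hc, hm⟩
  · rintro ⟨cs, hf, hd, hc, hm⟩
    rcases eq_or_ne cs [] with rfl | hne
    · exact Or.inl ⟨by simpa using hf.symm, by simpa using hm⟩
    · exact Or.inr ⟨cs, ⟨hf, hne, hd, hc⟩, hm⟩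

/-- A context that is maximal among the dependent prefixes cannot be properly extended. -/
theorem eq_nil_of_dependentWord_append {V : Type} {I : V → V → Prop} {c e r : List (Op V)}
    {cs : List (List (Op V))} (hne : ∀ d ∈ cs, d ≠ [])
    (hc : (c :: cs).IsChain (fun c d => ∀ a ∈ d.head?, ¬ DependentWord I (c ++ [a])))
    (hdep : DependentWord I (c ++ e)) (hf : cs.flatten = e ++ r) : e = [] := by
  rcases e with _ | ⟨x, e⟩
  · rfl
  rcases cs with _ | ⟨d, cs⟩
  · simp at hf
  rcases d with _ | ⟨y, d⟩
  · simp at hne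
  obtain rfl : y = x := by simp at hf; exact hf.1
  refine absurd (hdep.mono ?_) ((List.isChain_cons_cons.1 hc).1 y (by simp))
  intro z hz
  simp at hz ⊢
  tauto

theorem contexts_unique {V : Type} {I : V → V → Prop} {cs ds : List (List (Op V))}
    (hf : cs.flatten = ds.flatten)
    (hcs : ∀ c ∈ cs, c ≠ [] ∧ DependentWord I c)
    (hds : ∀ c ∈ ds, c ≠ [] ∧ DependentWord I c)
    (hcc : cs.IsChain (fun c d => ∀ a ∈ d.head?, ¬ DependentWord I (c ++ [a])))
    (hdc : ds.IsChain (fun c d => ∀ a ∈ d.head?, ¬ DependentWord I (c ++ [a]))) :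
    cs = ds := by
  induction cs generalizing ds with
  | nil =>
    rcases ds with _ | ⟨d, ds⟩
    · rfl
    · simp at hf hds
      exact absurd hf.1 hds.1.1
  | cons c cs ih =>
    rcases ds with _ | ⟨d, ds⟩
    · simp at hf hcs
      exact absurd hf.1 hcs.1.1
    have hcs' := List.forall_mem_cons.1 hcs
    have hds' := List.forall_mem_cons.1 hds
    rw [List.flatten_cons, List.flatten_cons] at hf
    obtain rfl : c = d := by
      rcases List.append_eq_append_iff.1 hf with ⟨e, rfl, he⟩ | ⟨e, rfl, he⟩
      · simp [eq_nil_of_dependentWord_append (fun x hx => (hcs'.2 x hx).1) hcc hds'.1.2 he]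
      · simp [eq_nil_of_dependentWord_append (fun x hx => (hds'.2 x hx).1) hdc hcs'.1.2 he]
    rw [ih (List.append_cancel_left hf) hcs'.2 hds'.2 hcc.tail hdc.tail]

theorem HasCS.unique {V : Type} {I : V → V → Prop} {w : List (Op V)} {m m' : ℤ}
    (h : HasCS I w m) (h' : HasCS I w m') : m = m' := by
  obtain ⟨cs, hf, hd, hc, rfl⟩ := hasCS_iff.1 h
  obtain ⟨ds, hf', hd', hc', rfl⟩ := hasCS_iff.1 h'
  rw [contexts_unique (hf.trans hf'.symm) hd hd' hc hc']

/-- If the letters at the junction of two words are independent, then every context switch of the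
concatenation is one of the two words or the junction itself. -/
theorem HasCS.append {V : Type} {I : V → V → Prop} {w w' : List (Op V)} {m m' : ℤ}
    (h : HasCS I w m) (h' : HasCS I w' m')
    (hj : ∀ x ∈ w.getLast?, ∀ y ∈ w'.head?, x.sym ≠ y.sym ∧ I x.sym y.sym) :
    HasCS I (w ++ w') (m + m' + 1) := by
  obtain ⟨cs, rfl, hd, hc, rfl⟩ := hasCS_iff.1 h
  obtain ⟨ds, rfl, hd', hc', rfl⟩ := hasCS_iff.1 h'
  refine hasCS_iff.2 ⟨cs ++ ds, by simp, ?_, ?_, by push_cast [List.length_append]; ring⟩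
  · intro c hc
    exact (List.mem_append.1 hc).elim (hd c) (hd' c)
  · refine List.isChain_append.2 ⟨hc, hc', fun c hcl d hdh a ha hdep => ?_⟩
    obtain ⟨cs, rfl⟩ : ∃ s, cs = s ++ [c] := List.getLast?_eq_some_iff.1 hcl
    obtain ⟨ds, rfl⟩ : ∃ t, ds = d :: t := List.head?_eq_some_iff.1 hdh
    obtain ⟨d, rfl⟩ : ∃ t, d = a :: t := List.head?_eq_some_iff.1 ha
    have hne : c ≠ [] := (hd c (by simp)).1
    obtain ⟨hxy, hI⟩ := hj (c.getLast hne)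
      (by simp [List.getLast?_append, List.getLast?_eq_getLast_of_ne_nil hne]) a (by simp)
    exact hdep _ (by simp) a (by simp) hxy hI

/-- Let `G = G₀ × G₁` (classes given by `P : V → Bool`, any two symbols from
different parts being independent).  For `w = u₀ v₁ u₁ v₂ u₂ ⋯ vₙ uₙ` with
`u₀, uₙ ∈ Ops₀*`, `u₁, …, u_{n-1} ∈ Ops₀⁺` and `v₁, …, vₙ ∈ Ops₁⁺`, we have
`cs(w) = cs(u₀) + Σ_{i=1}^{n} (cs(vᵢ) + cs(uᵢ) + 2)`. -/
theorem cs_of_alternating_product {V : Type} (I : V → V → Prop)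
    (hsym : ∀ a b : V, I a b → I b a)
    (P : V → Bool)
    (hcross : ∀ o₁ o₂ : V, P o₁ ≠ P o₂ → I o₁ o₂)
    (n : ℕ) (u v : ℕ → List (Op V))
    (hu : ∀ i ≤ n, ∀ a ∈ u i, P (Op.sym a) = false)
    (hv : ∀ i, 1 ≤ i → i ≤ n → ∀ a ∈ v i, P (Op.sym a) = true)
    (hune : ∀ i, 1 ≤ i → i ≤ n - 1 → u i ≠ [])
    (hvne : ∀ i, 1 ≤ i → i ≤ n → v i ≠ [])
    (m : ℤ) (a b : ℕ → ℤ)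
    (hw : HasCS I (u 0 ++ ((List.range n).map (fun i => v (i + 1) ++ u (i + 1))).flatten) m)
    (ha : ∀ i ≤ n, HasCS I (u i) (a i))
    (hb : ∀ i, 1 ≤ i → i ≤ n → HasCS I (v i) (b i)) :
    m = a 0 + ∑ i ∈ Finset.Icc 1 n, (b i + a i + 2) := by
  have hjoin : ∀ x y : Op V, P x.sym ≠ P y.sym → x.sym ≠ y.sym ∧ I x.sym y.sym :=
    fun x y h => ⟨fun he => h (he ▸ rfl), hcross _ _ h⟩
  suffices hprefix : ∀ k ≤ n,
      HasCS I (u 0 ++ ((List.range k).map (fun i => v (i + 1) ++ u (i + 1))).flatten)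
        (a 0 + ∑ i ∈ Finset.Icc 1 k, (b i + a i + 2)) from
    hw.unique (hprefix n le_rfl)
  intro k hk
  induction k with
  | zero => simpa using ha 0 hk
  | succ k ih =>
    have hv' := hv (k + 1) (by omega) hk
    have hvu : HasCS I (v (k + 1) ++ u (k + 1)) (b (k + 1) + a (k + 1) + 1) :=
      (hb (k + 1) (by omega) hk).append (ha (k + 1) hk) fun x hx y hy => hjoin x y <| by
        simp [hv' x (List.mem_of_getLast? hx), hu (k + 1) hk y (List.mem_of_head? hy)]
    have hlast : ∀ x ∈ (u 0 ++ ((List.range k).map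
        (fun i => v (i + 1) ++ u (i + 1))).flatten).getLast?, P x.sym = false := by
      intro x hx
      rcases k with _ | k
      · exact hu 0 (by omega) x (List.mem_of_getLast? (by simpa using hx))
      · have hne := hune (k + 1) (by omega) (by omega)
        refine hu (k + 1) (by omega) x (List.mem_of_getLast? ?_)
        rw [List.range_succ, List.map_append, List.flatten_append, List.map_singleton,
          List.flatten_singleton, ← List.append_assoc, ← List.append_assoc,
          List.getLast?_append_of_ne_nil _ hne] at hx
        exact hx
    have hstep := (ih (by omega)).append hvu fun x hx y hy => hjoin x y <| by
      rw [List.head?_append_of_ne_nil _ (hvne (k + 1) (by omega) hk)] at hy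
      simp [hlast x hx, hv' y (List.mem_of_head? hy)]
    rw [List.range_succ, List.map_append, List.flatten_append, List.map_singleton,
      List.flatten_singleton, ← List.append_assoc, Finset.sum_Icc_succ_top (by omega)]
    convert hstep using 1
    ring
end

section
/- If w = x₁ x₂ ⋯ xₙ is a computation (with each xᵢ ∈ Ops) and ⟦w⟧ = 1, then the sequence x₁, x₂, …, xₙ of single-letter computations is freely reducible. -/
/-- One step of a free reduction on a sequence of computations:
(FR1) delete two consecutive entries whose concatenation is `≅ ε`;
(FR2) swap two consecutive entries all of whose operations are mutually independent. -/
inductive FRStep {V : Type} (I : V → V → Prop) :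
    List (List (Op V)) → List (List (Op V)) → Prop
  | cancel (pre post : List (List (Op V))) (u v : List (Op V))
      (h : MCong I (u ++ v) []) :
      FRStep I (pre ++ [u, v] ++ post) (pre ++ post)
  | swap (pre post : List (List (Op V))) (u v : List (Op V))
      (h : ∀ a ∈ u, ∀ b ∈ v, I (Op.sym a) (Op.sym b)) :
      FRStep I (pre ++ [u, v] ++ post) (pre ++ [v, u] ++ post)

/-- A sequence of computations is freely reducible if finitely many applications of
(FR1) and (FR2) transform it into the empty sequence. -/
def FreelyReducible {V : Type} (I : V → V → Prop) (ws : List (List (Op V))) : Prop :=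
  Relation.ReflTransGen (FRStep I) ws []

/-- The operation with the same symbol and opposite sign. -/
def Op.inv {V : Type} : Op V → Op V
  | .pos o => .neg o
  | .neg o => .pos o

@[simp] theorem Op.sym_inv {V : Type} (a : Op V) : a.inv.sym = a.sym := by
  cases a <;> rfl

@[simp] theorem Op.inv_inv {V : Type} (a : Op V) : a.inv.inv = a := by
  cases a <;> rfl

/-- One directed rewriting step: swap adjacent independent operations, or delete an
adjacent pair `o⁺ o⁻`. -/
inductive RedStep {V : Type} (I : V → V → Prop) : List (Op V) → List (Op V) → Prop
  | swap (a b : Op V) (l : List (Op V)) (h : I a.sym b.sym) :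
      RedStep I (a :: b :: l) (b :: a :: l)
  | cancel (o : V) (l : List (Op V)) : RedStep I (.pos o :: .neg o :: l) l
  | cons (a : Op V) {l l' : List (Op V)} (h : RedStep I l l') : RedStep I (a :: l) (a :: l')

/-- Directed rewriting: finitely many rewriting steps. -/
abbrev Reduces {V : Type} (I : V → V → Prop) : List (Op V) → List (Op V) → Prop :=
  Relation.ReflTransGen (RedStep I)

/-- `Extract I b l l'`: the list `l'` arises from `l` by deleting an occurrence of `b` that
is preceded only by operations independent of `b`. -/
inductive Extract {V : Type} (I : V → V → Prop) (b : Op V) :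
    List (Op V) → List (Op V) → Prop
  | head (l : List (Op V)) : Extract I b (b :: l) l
  | cons (a : Op V) {l l' : List (Op V)} (hI : I a.sym b.sym) (h : Extract I b l l') :
      Extract I b (a :: l) (a :: l')

/-- `DeletePair I l l'`: the list `l'` arises from `l` by deleting two operations that cancel
each other once they are made adjacent. -/
inductive DeletePair {V : Type} (I : V → V → Prop) : List (Op V) → List (Op V) → Prop
  | head (a : Op V) {l l' : List (Op V)} (hp : (∃ o, a = .pos o) ∨ I a.sym a.sym)
      (h : Extract I a.inv l l') : DeletePair I (a :: l) l'
  | cons (a : Op V) {l l' : List (Op V)} (h : DeletePair I l l') :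
      DeletePair I (a :: l) (a :: l')

theorem Reduces.cons {V : Type} {I : V → V → Prop} (a : Op V) {l l' : List (Op V)}
    (h : Reduces I l l') : Reduces I (a :: l) (a :: l') :=
  h.lift (a :: ·) fun _ _ => RedStep.cons a

theorem RedStep.append {V : Type} {I : V → V → Prop} (s : List (Op V)) {l l' : List (Op V)}
    (h : RedStep I l l') : RedStep I (s ++ l) (s ++ l') := by
  induction s with
  | nil => exact h
  | cons a s ih => exact .cons a ih

theorem DeletePair.append {V : Type} {I : V → V → Prop} (s : List (Op V))
    {l l' : List (Op V)} (h : DeletePair I l l') : DeletePair I (s ++ l) (s ++ l') := by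
  induction s with
  | nil => exact h
  | cons a s ih => exact .cons a ih

theorem Extract.reduces_to_front {V : Type} {I : V → V → Prop} {b : Op V}
    {l l' : List (Op V)} (h : Extract I b l l') : Reduces I l (b :: l') := by
  induction h with
  | head l => exact .refl
  | cons a hI _ ih => exact (Reduces.cons a ih).tail (.swap a b _ hI)

theorem Extract.reduces_from_front {V : Type} {I : V → V → Prop}
    (hsym : ∀ a b : V, I a b → I b a) {b : Op V}
    {l l' : List (Op V)} (h : Extract I b l l') : Reduces I (b :: l') l := by
  induction h with
  | head l => exact .refl
  | cons a hI _ ih => exact .head (.swap b a _ (hsym _ _ hI)) (Reduces.cons a ih)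

/-- A rewriting step either commutes with the extraction of `b` or cancels the extracted
occurrence of `b`. -/
theorem Extract.redStep {V : Type} {I : V → V → Prop} (hsym : ∀ a b : V, I a b → I b a)
    {b : Op V} {l l' l₁ : List (Op V)} (h : Extract I b l l') (hs : RedStep I l l₁) :
    (∃ l₁', Reduces I l' l₁' ∧ Extract I b l₁ l₁') ∨ Extract I b.inv l' l₁ := by
  induction h generalizing l₁ with
  | head t =>
    cases hs with
    | swap _ y r hI => exact .inl ⟨_, .refl, .cons y (hsym _ _ hI) (.head r)⟩
    | cancel o r => exact .inr (.head _)
    | cons _ hs => exact .inl ⟨_, .single hs, .head _⟩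
  | cons x hI h ih =>
    cases hs with
    | swap _ y r hxy =>
      cases h with
      | head => exact .inl ⟨_, .refl, .head _⟩
      | cons _ hy h =>
        exact .inl ⟨_, .single (.swap x y _ hxy), .cons y hy (.cons x hI h)⟩
    | cancel o r =>
      cases h with
      | head => exact .inr (.head _)
      | cons _ hy h => exact .inl ⟨_, .single (.cancel o _), h⟩
    | cons _ hs =>
      rcases ih hs with ⟨l₁', hr, he⟩ | he
      · exact .inl ⟨_, hr.cons x, .cons x hI he⟩
      · exact .inr (.cons x (by simpa using hI) he)

theorem DeletePair.redStep {V : Type} {I : V → V → Prop} (hsym : ∀ a b : V, I a b → I b a)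
    {l l' l₁ : List (Op V)} (h : DeletePair I l l') (hs : RedStep I l l₁) :
    Reduces I l' l₁ ∨ ∃ l₁', Reduces I l' l₁' ∧ DeletePair I l₁ l₁' := by
  induction h generalizing l₁ with
  | head a hp h =>
    cases hs with
    | swap _ y r hI =>
      cases h with
      | head =>
        refine .inr ⟨_, .refl, .head a.inv (.inr (by simpa using hI)) ?_⟩
        rw [Op.inv_inv]
        exact .head _
      | cons _ _ h => exact .inr ⟨_, .refl, .cons y (.head a hp h)⟩
    | cancel o r =>
      cases h with
      | head => exact .inl .refl
      | cons _ _ h => exact .inl (h.reduces_from_front hsym)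
    | cons _ hs =>
      rcases h.redStep hsym hs with ⟨l₁', hr, he⟩ | he
      · exact .inr ⟨_, hr, .head a hp he⟩
      · rw [Op.inv_inv] at he
        exact .inl he.reduces_to_front
  | cons x h ih =>
    cases hs with
    | swap _ y r hI =>
      cases h with
      | head _ hp h =>
        exact .inr ⟨_, .refl, .head y hp (.cons x (by simpa using hI) h)⟩
      | cons _ h => exact .inr ⟨_, .single (.swap x y _ hI), .cons y (.cons x h)⟩
    | cancel o r =>
      cases h with
      | head _ _ h => exact .inl (h.reduces_from_front hsym)
      | cons _ h => exact .inr ⟨_, .single (.cancel o _), h⟩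
    | cons _ hs =>
      rcases ih hs with hr | ⟨l₁', hr, hd⟩
      · exact .inl (hr.cons x)
      · exact .inr ⟨_, hr.cons x, .cons x hd⟩

theorem DeletePair.reduces_nil {V : Type} {I : V → V → Prop}
    (hsym : ∀ a b : V, I a b → I b a) {l l' : List (Op V)} (h : DeletePair I l l')
    (hl : Reduces I l []) : Reduces I l' [] := by
  induction hl using Relation.ReflTransGen.head_induction_on generalizing l' with
  | refl => cases h
  | head hs hr ih =>
    rcases h.redStep hsym hs with h' | ⟨l₁', h', hd⟩
    · exact h'.trans hr
    · exact h'.trans (ih hd)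

theorem MGen.reduces_nil_iff {V : Type} {I : V → V → Prop}
    (hsym : ∀ a b : V, I a b → I b a) {l l' : List (Op V)} (h : MGen I l l') :
    Reduces I l [] ↔ Reduces I l' [] := by
  cases h with
  | swap s t a b h =>
    simp only [List.append_assoc, List.cons_append, List.nil_append]
    exact ⟨.head ((RedStep.swap b a t (hsym _ _ h)).append s),
      .head ((RedStep.swap a b t h).append s)⟩
  | cancel s t o =>
    simp only [List.append_assoc, List.cons_append, List.nil_append]
    exact ⟨((DeletePair.head (.pos o) (.inl ⟨o, rfl⟩) (.head t)).append s).reduces_nil hsym,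
      .head ((RedStep.cancel o t).append s)⟩

theorem MCong.reduces_nil_iff {V : Type} {I : V → V → Prop}
    (hsym : ∀ a b : V, I a b → I b a) {l l' : List (Op V)} (h : MCong I l l') :
    Reduces I l [] ↔ Reduces I l' [] := by
  induction h with
  | rel _ _ h => exact h.reduces_nil_iff hsym
  | refl => exact .rfl
  | symm _ _ _ ih => exact ih.symm
  | trans _ _ _ _ _ ih₁ ih₂ => exact ih₁.trans ih₂

theorem FRStep.cons {V : Type} {I : V → V → Prop} (u : List (Op V))
    {ws ws' : List (List (Op V))} (h : FRStep I ws ws') : FRStep I (u :: ws) (u :: ws') := by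
  cases h with
  | cancel pre post v w h => exact .cancel (u :: pre) post v w h
  | swap pre post v w h => exact .swap (u :: pre) post v w h

theorem RedStep.frStep {V : Type} {I : V → V → Prop} {l l' : List (Op V)}
    (h : RedStep I l l') :
    FRStep I (l.map (fun x => [x])) (l'.map (fun x => [x])) := by
  induction h with
  | swap a b l h => exact .swap [] (l.map (fun x => [x])) [a] [b] (by simpa using h)
  | cancel o l =>
    exact .cancel [] (l.map (fun x => [x])) [.pos o] [.neg o] (.rel _ _ (.cancel [] [] o))
  | cons a _ ih => exact ih.cons [a]

/-- If `w = x₁ ⋯ xₙ` is a computation with `⟦w⟧ = 1`, then the sequence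
`x₁, x₂, …, xₙ` of single-letter computations is freely reducible. -/
theorem singletons_freelyReducible {V : Type} (I : V → V → Prop)
    (hsym : ∀ a b : V, I a b → I b a)
    (w : List (Op V)) (h : MCong I w []) :
    FreelyReducible I (w.map (fun x => [x])) := by
  exact ((h.reduces_nil_iff hsym).2 .refl).lift (List.map fun x => [x])
    fun _ _ => RedStep.frStep
end
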